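/- Titchmarsh-type theorem (absence of divisors of zero): let f, g ∈ L²(0,∞) be such that their Mellin transforms f*, g* converge absolutely on the critical line Re s = 1/2 and satisfy ∫_{-∞}^{∞} e^{π|1/2 + iτ|} |f*(1/2 + iτ)| dτ < ∞ and ∫_{-∞}^{∞} e^{π|1/2 + iθ|} |g*(1/2 + iθ)| dθ < ∞. If the Mellin–Barnes convolution (f ⋆ g)(x) = 0 for every x > 0, then f = 0 almost everywhere on (0,∞) or g = 0 almost everywhere on (0,∞). -/

import Mathlib

open MeasureTheory Set Filter
open scoped Real

/-- The Mellin–Barnes convolution kernel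
`Γ(s)Γ(w)/Γ(s+w-1/2) · [sin(π(s+w)/2) + cos(π(s-w)/2)]/sin(π(s+w)/2)`. -/
noncomputable def mbKernel (s w : ℂ) : ℂ :=
  Complex.Gamma s * Complex.Gamma w / Complex.Gamma (s + w - 1 / 2) *
    ((Complex.sin (π * (s + w) / 2) + Complex.cos (π * (s - w) / 2)) /
      Complex.sin (π * (s + w) / 2))

/-- The Mellin–Barnes convolution of `f` and `g`, related to the half-Hartley transform. -/
noncomputable def mbConv (f g : ℝ → ℂ) (x : ℝ) : ℂ :=
  ((((2 * π) ^ 2)⁻¹ : ℝ) : ℂ) * ∫ p : ℝ × ℝ,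
    mbKernel (1 / 2 + p.1 * Complex.I) (1 / 2 + p.2 * Complex.I) *
      mellin f (1 - (1 / 2 + p.1 * Complex.I)) * mellin g (1 - (1 / 2 + p.2 * Complex.I)) *
      (x : ℂ) ^ ((1 / 2 + p.1 * Complex.I) + (1 / 2 + p.2 * Complex.I) - 3 / 2)

section Helpers
open FourierTransform

theorem mb_fourier_inj (h : ℝ → ℂ) (hh : Integrable h) (h0 : ∀ ξ, 𝓕 h ξ = 0) :
    h =ᵐ[volume] 0 := by
  apply ae_eq_zero_of_integral_contDiff_smul_eq_zero hh.locallyIntegrable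
  intro g hg hgs
  have hg1 : ContDiff ℝ (⊤ : ℕ∞) (fun x => (g x : ℂ)) :=
    Complex.ofRealCLM.contDiff.comp hg
  have hg2 : HasCompactSupport (fun x => (g x : ℂ)) :=
    hgs.comp_left (g := fun x : ℝ => (x : ℂ)) (by simp)
  let ψ : SchwartzMap ℝ ℂ := hg2.toSchwartzMap hg1
  let φ : SchwartzMap ℝ ℂ := 𝓕⁻ ψ
  have hφ : 𝓕 φ = ψ := by simp [φ]
  have hφ' : 𝓕 (φ : ℝ → ℂ) = fun x => (g x : ℂ) := by
    rw [← SchwartzMap.fourier_coe, hφ]; rfl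
  have key := VectorFourier.integral_fourierIntegral_smul_eq_flip (L := innerₗ ℝ)
    Real.continuous_fourierChar continuous_inner φ.integrable hh (μ := volume) (ν := volume)
  have e1 : ∀ ξ, VectorFourier.fourierIntegral 𝐞 volume (innerₗ ℝ) (φ : ℝ → ℂ) ξ = (g ξ : ℂ) := by
    intro ξ; exact congrFun hφ' ξ
  have e2 : ∀ ξ, VectorFourier.fourierIntegral 𝐞 volume (innerₗ ℝ).flip h ξ = 0 := by
    intro ξ; rw [flip_innerₗ]; exact h0 ξ
  simp only [e1, e2] at key
  simpa using key

theorem mb_phi_integrable (f : ℝ → ℂ) (s : ℂ) 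
    (hfm : IntegrableOn (fun t : ℝ => (t : ℂ) ^ (s - 1) • f t) (Ioi 0)) :
    Integrable (fun u : ℝ => Real.exp (-s.re * u) • f (Real.exp (-u))) := by
  have hd : ∀ x ∈ (univ : Set ℝ),
      HasDerivWithinAt (fun u : ℝ => Real.exp (-u)) (-Real.exp (-x)) univ x := by
    intro x _
    have := (Real.hasDerivAt_exp (-x)).comp x (hasDerivAt_neg x)
    rw [mul_neg_one] at this
    exact this.hasDerivWithinAt
  have hi : InjOn (fun u : ℝ => Real.exp (-u)) univ := by
    intro a _ b _ hab
    simpa using hab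
  have him : (fun u : ℝ => Real.exp (-u)) '' univ = Ioi 0 := by
    ext y; constructor
    · rintro ⟨x, -, rfl⟩; exact Real.exp_pos _
    · intro hy; exact ⟨-Real.log y, trivial, by simpa using Real.exp_log hy⟩
  rw [← him, integrableOn_image_iff_integrableOn_abs_deriv_smul MeasurableSet.univ hd hi] at hfm
  rw [integrableOn_univ] at hfm
  have hb := hfm.bdd_mul (c := 1) (f := fun u : ℝ => Complex.exp (s.im * u * Complex.I)) 
    (by fun_prop) (ae_of_all _ (fun u => by
      rw [show (s.im * u * Complex.I : ℂ) = ((s.im * u : ℝ) : ℂ) * Complex.I by push_cast; ring, Complex.norm_exp_ofReal_mul_I]))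
  refine hb.congr (ae_of_all _ fun u => ?_)
  simp only [abs_neg, abs_of_pos (Real.exp_pos _), smul_eq_mul, Complex.real_smul]
  rw [Complex.cpow_def_of_ne_zero (by simp), ← Complex.ofReal_log (Real.exp_pos _).le, Real.log_exp]
  push_cast
  rw [← mul_assoc, ← mul_assoc, ← Complex.exp_add, ← Complex.exp_add]
  congr 2
  have hs := Complex.re_add_im s
  linear_combination (u : ℂ) * hs

theorem mb_mellin_cont (f : ℝ → ℂ)
    (hfm : ∀ s : ℂ, s.re = 1 / 2 →
      IntegrableOn (fun t : ℝ => (t : ℂ) ^ (s - 1) • f t) (Ioi 0)) :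
    Continuous (fun τ : ℝ => mellin f (1 / 2 + τ * Complex.I)) := by
  have h1 := mb_phi_integrable f (1/2) (hfm _ (by simp))
  have h2 : Continuous (𝓕 (fun u : ℝ => Real.exp (-(1/2 : ℂ).re * u) • f (Real.exp (-u)))) :=
    VectorFourier.fourierIntegral_continuous Real.continuous_fourierChar
      continuous_inner h1 (L := innerₗ ℝ)
  simp_rw [mellin_eq_fourier]
  have : ∀ τ : ℝ, (1 / 2 + τ * Complex.I : ℂ).re = (1 / 2 : ℂ).re := by simp
  simp_rw [this]
  refine h2.comp ?_
  simp
  fun_prop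

theorem mb_mellin_zero (f : ℝ → ℂ)
    (hfm : ∀ s : ℂ, s.re = 1 / 2 →
      IntegrableOn (fun t : ℝ => (t : ℂ) ^ (s - 1) • f t) (Ioi 0))
    (h0 : ∀ τ : ℝ, mellin f (1 / 2 + τ * Complex.I) = 0) :
    f =ᵐ[volume.restrict (Ioi (0 : ℝ))] 0 := by
  have h1 := mb_phi_integrable f (1/2) (hfm _ (by simp))
  have h2 := mb_fourier_inj _ h1 (fun ξ => by
    have := h0 (2 * π * ξ)
    rw [mellin_eq_fourier] at this
    convert this using 2
    · simp
    · simp)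
  have h3 : mellin (fun t => (‖f t‖ : ℂ)) (1/2) = 0 := by
    rw [mellin_eq_fourier, Real.fourier_eq]
    apply integral_eq_zero_of_ae
    filter_upwards [h2] with u hu
    have : f (Real.exp (-u)) = 0 := by simpa using hu
    simp [this]
  have h4 : ∫ t in Ioi (0:ℝ), ‖(t : ℂ) ^ ((1/2 : ℂ) - 1) • f t‖ = 0 := by
    have : ((∫ t in Ioi (0:ℝ), ‖(t : ℂ) ^ ((1/2 : ℂ) - 1) • f t‖ : ℝ) : ℂ) = 0 := by
      rw [← h3, mellin, ← integral_complex_ofReal]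
      apply setIntegral_congr_fun measurableSet_Ioi
      intro t ht
      have ht' : (0:ℝ) < t := ht
      simp only [smul_eq_mul]
      rw [norm_mul, Complex.norm_cpow_eq_rpow_re_of_pos ht', Complex.ofReal_mul,
        Complex.ofReal_cpow ht'.le]
      congr 2
      simp
    exact_mod_cast this
  rw [integral_eq_zero_iff_of_nonneg (fun _ => norm_nonneg _) (hfm _ (by simp)).norm] at h4
  filter_upwards [h4, ae_restrict_mem measurableSet_Ioi] with t ht ht0
  have ht' : (0:ℝ) < t := ht0
  have : (t : ℂ) ≠ 0 := by exact_mod_cast ht'.ne'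
  simpa [Complex.cpow_eq_zero_iff, this] using ht

theorem mb_gamma_sq (u : ℝ) :
    ‖Complex.Gamma (1 / 2 + u * Complex.I)‖ ^ 2 = π / Real.cosh (π * u) := by
  have h := Complex.Gamma_mul_Gamma_one_sub (1 / 2 + u * Complex.I)
  have e : (1 - (1 / 2 + u * Complex.I) : ℂ) = (starRingEnd ℂ) (1 / 2 + u * Complex.I) := by
    apply Complex.ext <;> simp; norm_num
  rw [e, Complex.Gamma_conj, Complex.mul_conj, Complex.normSq_eq_norm_sq] at h
  have e2 : Complex.sin (π * (1 / 2 + u * Complex.I)) = Real.cosh (π * u) := by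
    rw [show (π * (1 / 2 + u * Complex.I) : ℂ) = (π * u : ℝ) * Complex.I + π / 2 by push_cast; ring,
      Complex.sin_add_pi_div_two, Complex.cos_mul_I]
    push_cast; rfl
  rw [e2] at h
  exact_mod_cast h

theorem mb_cosh_ge (x : ℝ) : Real.exp |x| / 2 ≤ Real.cosh x := by
  rw [← Real.cosh_abs, Real.cosh_eq]
  have := Real.exp_pos (-|x|)
  linarith

/-- The Hartley factor. -/
noncomputable def mbC (s : ℂ) : ℂ := Complex.cos (π * s / 2) + Complex.sin (π * s / 2)

theorem mb_norm_cos (z : ℂ) : ‖Complex.cos z‖ ≤ Real.exp |z.im| := by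
  rw [Complex.cos, norm_div]
  have h1 := norm_add_le (Complex.exp (z * Complex.I)) (Complex.exp (-z * Complex.I))
  rw [Complex.norm_exp, Complex.norm_exp] at h1
  simp at h1 ⊢
  have h2 := Real.exp_le_exp.2 (le_abs_self z.im)
  have h3 := Real.exp_le_exp.2 (neg_le_abs z.im)
  linarith

theorem mb_norm_C (τ : ℝ) : ‖mbC (1 / 2 + τ * Complex.I)‖ ≤ 2 * Real.exp (|π * τ| / 2) := by
  have h1 := mb_norm_cos (π * (1 / 2 + τ * Complex.I) / 2)
  have h2 := mb_norm_cos (π * (1 / 2 + τ * Complex.I) / 2 - π / 2)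
  rw [Complex.cos_sub_pi_div_two] at h2
  have e1 : (π * (1 / 2 + τ * Complex.I) / 2 : ℂ).im = π * τ / 2 := by simp
  have e2 : (π * (1 / 2 + τ * Complex.I) / 2 - π / 2 : ℂ).im = π * τ / 2 := by simp
  rw [e1, abs_div, abs_two] at h1
  rw [e2, abs_div, abs_two] at h2
  refine (norm_add_le _ _).trans ?_
  linarith

theorem mb_GC_bound (τ : ℝ) :
    ‖Complex.Gamma (1 / 2 + τ * Complex.I) * mbC (1 / 2 + τ * Complex.I)‖ ≤ 8 * π := by
  have h1 := mb_gamma_sq τ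
  have h2 := mb_norm_C τ
  have h3 := mb_cosh_ge (π * τ)
  have hp : 3 < π := Real.pi_gt_three
  refine (sq_le_sq₀ (by positivity) (by positivity)).1 ?_
  rw [norm_mul, mul_pow, h1]
  have h4 : ‖mbC (1 / 2 + τ * Complex.I)‖ ^ 2 ≤ 4 * Real.exp |π * τ| := by
    calc _ ≤ (2 * Real.exp (|π * τ| / 2)) ^ 2 := by gcongr
      _ = _ := by rw [mul_pow, ← Real.exp_nat_mul]; norm_num; ring
  have hc := Real.cosh_pos (π * τ)
  rw [div_mul_eq_mul_div, div_le_iff₀ hc]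
  nlinarith [mul_le_mul_of_nonneg_left h4 Real.pi_pos.le, mul_pos Real.pi_pos hc]

theorem mb_C_ne (τ : ℝ) : mbC (1 / 2 + τ * Complex.I) ≠ 0 := by
  intro h
  have h2 : mbC (1 / 2 + τ * Complex.I) ^ 2 = 1 + Complex.sin (π * (1 / 2 + τ * Complex.I)) := by
    have h3 := Complex.sin_two_mul (π * (1 / 2 + τ * Complex.I) / 2)
    rw [mul_div_cancel₀ _ two_ne_zero] at h3
    rw [mbC, h3]
    have := Complex.sin_sq_add_cos_sq (π * (1 / 2 + τ * Complex.I) / 2)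
    linear_combination this
  rw [h, show (π * (1 / 2 + τ * Complex.I) : ℂ) = (π * τ : ℝ) * Complex.I + π / 2 by push_cast; ring,
      Complex.sin_add_pi_div_two, Complex.cos_mul_I] at h2
  have h3 : (0:ℝ) ^ 2 = 1 + Real.cosh (π * τ) := by
    apply Complex.ofReal_injective
    push_cast
    simpa using h2
  have := Real.cosh_pos (π * τ)
  norm_num at h3
  linarith

/-- The multiplier. -/
noncomputable def mbM (u : ℝ) : ℂ :=
  (Complex.Gamma (1 / 2 + u * Complex.I) * Real.cosh (π * u / 2))⁻¹

theorem mb_gamma_ne (u : ℝ) : Complex.Gamma (1 / 2 + u * Complex.I) ≠ 0 :=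
  Complex.Gamma_ne_zero_of_re_pos (by simp)

theorem mb_M_ne (u : ℝ) : mbM u ≠ 0 := by
  apply inv_ne_zero
  refine mul_ne_zero (mb_gamma_ne u) ?_
  exact_mod_cast (Real.cosh_pos _).ne'

theorem mb_gamma_cont : Continuous (fun u : ℝ => Complex.Gamma (1 / 2 + u * Complex.I)) := by
  rw [continuous_iff_continuousAt]
  intro u
  have h : ContinuousAt Complex.Gamma (1 / 2 + u * Complex.I) := by
    refine (Complex.differentiableAt_Gamma _ ?_).continuousAt
    intro m hm
    have := congrArg Complex.re hm
    simp at this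
    have h2 : (0:ℝ) ≤ m := by positivity
    norm_num at this
    linarith
  exact ContinuousAt.comp (f := fun u : ℝ => (1 / 2 + u * Complex.I : ℂ)) h (by fun_prop)

theorem mb_M_cont : Continuous mbM := by
  refine Continuous.inv₀ (mb_gamma_cont.mul ?_) fun u => fun h => mb_M_ne u (by rw [mbM, h, inv_zero])
  exact Complex.continuous_ofReal.comp (Real.continuous_cosh.comp (by fun_prop))

theorem mb_M_bound (u : ℝ) : ‖mbM u‖ ≤ 1 := by
  have h1 := mb_gamma_sq u
  have hc := Real.cosh_pos (π * u)
  have hc2 := Real.cosh_pos (π * u / 2)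
  have h2 : Real.cosh (π * u) = 2 * Real.cosh (π * u / 2) ^ 2 - 1 := by
    rw [show π * u = 2 * (π * u / 2) by ring, Real.cosh_two_mul, Real.sinh_sq]; ring_nf
  rw [mbM, norm_inv]
  apply inv_le_one_of_one_le₀
  refine (sq_le_sq₀ (by positivity) (by positivity)).1 ?_
  rw [norm_mul, mul_pow, h1, Complex.norm_real, Real.norm_eq_abs, sq_abs, one_pow,
    div_mul_eq_mul_div, le_div_iff₀ hc]
  nlinarith [Real.pi_gt_three, pow_pos hc2 2]


theorem mb_analytic (F : ℝ → ℂ) (hc : Continuous F)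
    (hF : Integrable (fun τ : ℝ => Real.exp (π * |τ|) * ‖F τ‖)) :
    AnalyticOnNhd ℝ (𝓕 F) univ := by
  let A : ℂ → ℂ := fun z => ∫ τ : ℝ, Complex.exp (-2 * π * τ * z * Complex.I) * F τ
  let S : Set ℂ := {z | |z.im| < 1 / 4}
  have hS : IsOpen S := isOpen_lt (by fun_prop) continuous_const
  have hn : ∀ z ∈ S, ∀ τ : ℝ, ‖Complex.exp (-2 * π * τ * z * Complex.I)‖ ≤
      Real.exp (π * |τ| / 2) := by
    intro z hz τ
    have hz' : |z.im| < 1 / 4 := hz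
    rw [Complex.norm_exp]
    apply Real.exp_le_exp.2
    have e : (-2 * π * τ * z * Complex.I : ℂ).re = 2 * π * (τ * z.im) := by simp; ring
    rw [e]
    have h1 : τ * z.im ≤ |τ| * (1 / 4) := by
      calc τ * z.im ≤ |τ * z.im| := le_abs_self _
        _ = |τ| * |z.im| := abs_mul _ _
        _ ≤ _ := by gcongr
    nlinarith [Real.pi_pos, mul_le_mul_of_nonneg_left h1 Real.pi_pos.le]
  have hA : DifferentiableOn ℂ A S := by
    intro z hz
    have := hasDerivAt_integral_of_dominated_loc_of_deriv_le (μ := volume)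
      (F := fun (z : ℂ) (τ : ℝ) => Complex.exp (-2 * π * τ * z * Complex.I) * F τ)
      (F' := fun (z : ℂ) (τ : ℝ) =>
        Complex.exp (-2 * π * τ * z * Complex.I) * (-2 * π * τ * Complex.I) * F τ)
      (bound := fun τ => 4 * (Real.exp (π * |τ|) * ‖F τ‖)) (hS.mem_nhds hz)
      (Eventually.of_forall fun z => by
        apply Continuous.aestronglyMeasurable; fun_prop)
      (by
        refine hF.mono' (by apply Continuous.aestronglyMeasurable; fun_prop)
          (ae_of_all _ fun τ => ?_)
        rw [norm_mul]
        gcongr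
        refine (hn z hz τ).trans (Real.exp_le_exp.2 ?_)
        have : 0 ≤ π * |τ| := by positivity
        linarith)
      (by apply Continuous.aestronglyMeasurable; fun_prop)
      (ae_of_all _ fun τ w hw => by
        rw [norm_mul, norm_mul, ← mul_assoc]
        refine mul_le_mul_of_nonneg_right ?_ (norm_nonneg _)
        have h1 := hn w hw τ
        have h2 : ‖(-2 * π * τ * Complex.I : ℂ)‖ = 2 * π * |τ| := by
          simp [abs_of_pos Real.pi_pos]
        have h3 := Real.add_one_le_exp (π * |τ| / 2)
        have h4 : Real.exp (π * |τ|) = Real.exp (π * |τ| / 2) * Real.exp (π * |τ| / 2) := by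
          rw [← Real.exp_add]; ring_nf
        rw [h2, h4]
        calc _ ≤ Real.exp (π * |τ| / 2) * (4 * Real.exp (π * |τ| / 2)) := by
              refine mul_le_mul h1 ?_ (by positivity) (by positivity)
              linarith
          _ = _ := by ring)
      (hF.const_mul 4)
      (ae_of_all _ fun τ w hw => by
        have h1 : HasDerivAt (fun z : ℂ => -2 * π * τ * z * Complex.I)
            (-2 * π * τ * Complex.I) w := by
          simpa using ((hasDerivAt_id w).const_mul (-2 * π * τ : ℂ)).mul_const Complex.I
        exact h1.cexp.mul_const _)
    exact this.2.differentiableAt.differentiableWithinAt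
  have hE : 𝓕 F = fun ξ : ℝ => A (Complex.ofRealCLM ξ) := by
    ext ξ
    rw [Real.fourier_eq']
    apply integral_congr_ae
    refine ae_of_all _ fun τ => ?_
    simp only [smul_eq_mul]
    congr 2
    simp
    ring
  rw [hE]
  intro ξ _
  have h1 : AnalyticAt ℂ A (Complex.ofRealCLM ξ) :=
    hA.analyticAt (hS.mem_nhds (by simp [S]))
  exact (h1.restrictScalars (𝕜 := ℝ)).comp (Complex.ofRealCLM.analyticAt ξ)

/-- The transformed Mellin function. -/
noncomputable def mbF (f : ℝ → ℂ) (τ : ℝ) : ℂ :=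
  Complex.Gamma (1 / 2 + τ * Complex.I) * mbC (1 / 2 + τ * Complex.I) *
    mellin f (1 - (1 / 2 + τ * Complex.I))

theorem mb_F_props (f : ℝ → ℂ)
    (hfm : ∀ s : ℂ, s.re = 1 / 2 →
      IntegrableOn (fun t : ℝ => (t : ℂ) ^ (s - 1) • f t) (Ioi 0))
    (hfE : Integrable (fun τ : ℝ =>
      Real.exp (π * ‖(1 / 2 + τ * Complex.I : ℂ)‖) *
        ‖mellin f (1 / 2 + τ * Complex.I)‖)) :
    Continuous (mbF f) ∧ Integrable (fun τ : ℝ => Real.exp (π * |τ|) * ‖mbF f τ‖) ∧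
      Integrable (mbF f) ∧ ((∀ ξ, 𝓕 (mbF f) ξ = 0) →
        f =ᵐ[volume.restrict (Ioi (0 : ℝ))] 0) := by
  have e : ∀ τ : ℝ, (1 - (1 / 2 + τ * Complex.I) : ℂ) = 1 / 2 + (-τ : ℝ) * Complex.I := by
    intro τ; push_cast; ring
  have hm := mb_mellin_cont f hfm
  have hc : Continuous (mbF f) := by
    unfold mbF
    simp_rw [e]
    refine (mb_gamma_cont.mul ?_).mul (hm.comp continuous_neg)
    unfold mbC
    fun_prop
  have hw : Integrable (fun τ : ℝ => Real.exp (π * |τ|) * ‖mbF f τ‖) := by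
    refine (hfE.comp_neg.const_mul (8 * π)).mono' (by fun_prop) (ae_of_all _ fun τ => ?_)
    rw [Real.norm_of_nonneg (by positivity), mbF, norm_mul, e]
    have h1 := mb_GC_bound τ
    have h2 : |τ| ≤ ‖(1 / 2 + (-τ : ℝ) * Complex.I : ℂ)‖ := by
      simpa using Complex.abs_im_le_norm (1 / 2 + (-τ : ℝ) * Complex.I : ℂ)
    have h3 : Real.exp (π * |τ|) ≤ Real.exp (π * ‖(1 / 2 + (-τ : ℝ) * Complex.I : ℂ)‖) := by
      apply Real.exp_le_exp.2
      have := Real.pi_pos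
      gcongr
    calc _ ≤ Real.exp (π * ‖(1 / 2 + (-τ : ℝ) * Complex.I : ℂ)‖) *
          (8 * π * ‖mellin f (1 / 2 + (-τ : ℝ) * Complex.I)‖) := by gcongr
      _ = _ := by ring
  have hi : Integrable (mbF f) := by
    refine hw.mono' hc.aestronglyMeasurable (ae_of_all _ fun τ => ?_)
    have : 1 ≤ Real.exp (π * |τ|) := Real.one_le_exp (by positivity)
    nlinarith [norm_nonneg (mbF f τ)]
  refine ⟨hc, hw, hi, fun h0 => ?_⟩
  have h1 : mbF f = 0 := (hc.ae_eq_iff_eq volume continuous_zero).1 (mb_fourier_inj _ hi h0)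
  apply mb_mellin_zero f hfm
  intro τ
  have h2 := congrFun h1 (-τ)
  simp only [mbF, Pi.zero_apply, mul_eq_zero, mb_gamma_ne, mb_C_ne, false_or, e, neg_neg] at h2
  exact h2

theorem mb_change (F G M : ℝ → ℂ) (hF : Integrable F) (hG : Integrable G) (hM : Continuous M)
    (C : ℝ) (hC : ∀ u, ‖M u‖ ≤ C) :
    ∫ p : ℝ × ℝ, F p.1 * G p.2 * M (p.1 + p.2) =
      ∫ u, M u * (convolution F G (ContinuousLinearMap.mul ℂ ℂ) volume) u := by
  have h1 : Integrable (fun p : ℝ × ℝ => F p.1 * G p.2 * M (p.1 + p.2)) := by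
    refine (hF.mul_prod hG).mul_bdd (c := C) ?_ (ae_of_all _ fun p => hC _)
    apply Continuous.aestronglyMeasurable; fun_prop
  have h2 := (hF.convolution_integrand (ContinuousLinearMap.mul ℂ ℂ) hG (μ := volume) (ν := volume))
  have h3 : Integrable (fun p : ℝ × ℝ => M p.1 * (F p.2 * G (p.1 - p.2)))
      (volume.prod volume) := by
    refine h2.bdd_mul (c := C) ?_ (ae_of_all _ fun p => hC _)
    apply Continuous.aestronglyMeasurable; fun_prop
  rw [Measure.volume_eq_prod, integral_prod _ h1]
  calc _ = ∫ a, ∫ u, M u * (F a * G (u - a)) := by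
        congr with a
        rw [← integral_sub_right_eq_self _ a]
        congr with u
        simp only [add_sub_cancel]
        ring
    _ = ∫ u, ∫ a, M u * (F a * G (u - a)) := (integral_integral_swap h3).symm
    _ = _ := by
        congr with u
        rw [integral_const_mul]
        rfl

end Helpers

open FourierTransform in
theorem mb_conv_eq (f g : ℝ → ℂ) (hF : Integrable (mbF f)) (hG : Integrable (mbF g)) (ξ : ℝ)
    (h : mbConv f g (Real.exp (-(2 * π * ξ))) = 0) :
    𝓕 (fun u => mbM u * (convolution (mbF f) (mbF g) (ContinuousLinearMap.mul ℂ ℂ) volume) u) ξ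
      = 0 := by
  have hM : Continuous fun u : ℝ => Complex.exp (-2 * π * u * ξ * Complex.I) * mbM u :=
    Continuous.mul (by fun_prop) mb_M_cont
  have h1 := mb_change (mbF f) (mbF g) _ hF hG hM 1 (fun u => by
    rw [norm_mul, show (-2 * π * u * ξ * Complex.I : ℂ) = (-2 * π * u * ξ : ℝ) * Complex.I by
      push_cast; ring, Complex.norm_exp_ofReal_mul_I, one_mul]
    exact mb_M_bound u)
  rw [Real.fourier_eq']
  have h2 : ∀ u : ℝ, Complex.exp (((-2 * π * inner ℝ u ξ : ℝ) : ℂ) * Complex.I) •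
      (mbM u * (convolution (mbF f) (mbF g) (ContinuousLinearMap.mul ℂ ℂ) volume) u) =
      Complex.exp (-2 * π * u * ξ * Complex.I) * mbM u *
      (convolution (mbF f) (mbF g) (ContinuousLinearMap.mul ℂ ℂ) volume) u := by
    intro u
    rw [smul_eq_mul, ← mul_assoc]
    congr 3
    simp
    ring
  rw [integral_congr_ae (ae_of_all _ h2), ← h1]
  rw [mbConv] at h
  have hp : ((((2 * π) ^ 2)⁻¹ : ℝ) : ℂ) ≠ 0 := by
    have := Real.pi_pos
    exact_mod_cast (by positivity : ((2 * π) ^ 2)⁻¹ ≠ 0)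
  have h3 := (mul_eq_zero.1 h).resolve_left hp
  have h4 : ∀ p : ℝ × ℝ,
      mbKernel (1 / 2 + p.1 * Complex.I) (1 / 2 + p.2 * Complex.I) *
      mellin f (1 - (1 / 2 + p.1 * Complex.I)) * mellin g (1 - (1 / 2 + p.2 * Complex.I)) *
      ((Real.exp (-(2 * π * ξ)) : ℝ) : ℂ) ^
        ((1 / 2 + p.1 * Complex.I) + (1 / 2 + p.2 * Complex.I) - 3 / 2 : ℂ) =
      Complex.exp (π * ξ) * (mbF f p.1 * mbF g p.2 *
        (Complex.exp (-2 * π * (p.1 + p.2 : ℝ) * ξ * Complex.I) * mbM (p.1 + p.2))) := by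
    rintro ⟨a, b⟩
    simp only
    have ex : ((Real.exp (-(2 * π * ξ)) : ℝ) : ℂ) ^
        ((1 / 2 + a * Complex.I) + (1 / 2 + b * Complex.I) - 3 / 2 : ℂ) =
        Complex.exp (π * ξ) * Complex.exp (-2 * π * (a + b : ℝ) * ξ * Complex.I) := by
      rw [Complex.cpow_def_of_ne_zero (by simp), ← Complex.ofReal_log (Real.exp_pos _).le,
        Real.log_exp, ← Complex.exp_add]
      congr 1
      push_cast
      ring
    have ek : mbKernel (1 / 2 + a * Complex.I) (1 / 2 + b * Complex.I) =
        Complex.Gamma (1 / 2 + a * Complex.I) * mbC (1 / 2 + a * Complex.I) *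
        (Complex.Gamma (1 / 2 + b * Complex.I) * mbC (1 / 2 + b * Complex.I)) * mbM (a + b) := by
      generalize hs : (1 / 2 + a * Complex.I : ℂ) = s
      generalize hw : (1 / 2 + b * Complex.I : ℂ) = w
      have e1 : s + w - 1 / 2 = 1 / 2 + (a + b : ℝ) * Complex.I := by
        rw [← hs, ← hw]; push_cast; ring
      have e2 : Complex.sin (π * (s + w) / 2) = Real.cosh (π * (a + b) / 2) := by
        rw [show π * (s + w) / 2 = (π * (a + b) / 2 : ℝ) * Complex.I + π / 2 by
          rw [← hs, ← hw]; push_cast; ring,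
          Complex.sin_add_pi_div_two, Complex.cos_mul_I]
        push_cast; rfl
      have e3 : Complex.sin (π * (s + w) / 2) + Complex.cos (π * (s - w) / 2) =
          mbC s * mbC w := by
        rw [mbC, mbC, show π * (s + w) / 2 = π * s / 2 + π * w / 2 by ring,
          show π * (s - w) / 2 = π * s / 2 - π * w / 2 by ring, Complex.sin_add, Complex.cos_sub]
        ring
      rw [mbKernel, e3, e2, e1, mbM, mul_inv, div_eq_mul_inv, div_eq_mul_inv]
      ring
    rw [ex, ek, mbF, mbF]
    ring
  rw [integral_congr_ae (ae_of_all _ h4), integral_const_mul] at h3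
  exact (mul_eq_zero.1 h3).resolve_left (Complex.exp_ne_zero _)

/-- Titchmarsh-type theorem for the Mellin–Barnes convolution: under the exponential
integrability conditions on the Mellin transforms of `f` and `g` along the critical line,
the convolution `f ⋆ g` has no divisors of zero. -/
theorem mbConv_titchmarsh (f g : ℝ → ℂ)
    (hf2 : MemLp f 2 (volume.restrict (Ioi (0 : ℝ))))
    (hg2 : MemLp g 2 (volume.restrict (Ioi (0 : ℝ))))
    (hfm : ∀ s : ℂ, s.re = 1 / 2 →
      IntegrableOn (fun t : ℝ => (t : ℂ) ^ (s - 1) • f t) (Ioi 0))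
    (hgm : ∀ s : ℂ, s.re = 1 / 2 →
      IntegrableOn (fun t : ℝ => (t : ℂ) ^ (s - 1) • g t) (Ioi 0))
    (hfE : Integrable (fun τ : ℝ =>
      Real.exp (π * ‖(1 / 2 + τ * Complex.I : ℂ)‖) *
        ‖mellin f (1 / 2 + τ * Complex.I)‖))
    (hgE : Integrable (fun θ : ℝ =>
      Real.exp (π * ‖(1 / 2 + θ * Complex.I : ℂ)‖) *
        ‖mellin g (1 / 2 + θ * Complex.I)‖))
    (hzero : ∀ x : ℝ, 0 < x → mbConv f g x = 0) :
    f =ᵐ[volume.restrict (Ioi (0 : ℝ))] 0 ∨ g =ᵐ[volume.restrict (Ioi (0 : ℝ))] 0 := by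
  obtain ⟨hcF, hwF, hiF, hzF⟩ := mb_F_props f hfm hfE
  obtain ⟨hcG, hwG, hiG, hzG⟩ := mb_F_props g hgm hgE
  have hconv : Integrable
      (convolution (mbF f) (mbF g) (ContinuousLinearMap.mul ℂ ℂ) volume) :=
    hiF.integrable_convolution _ hiG
  have h1 := mb_fourier_inj
    (fun u => mbM u * (convolution (mbF f) (mbF g) (ContinuousLinearMap.mul ℂ ℂ) volume) u)
    (hconv.bdd_mul (c := 1) mb_M_cont.aestronglyMeasurable (ae_of_all _ mb_M_bound))
    (fun ξ => mb_conv_eq f g hiF hiG ξ (hzero _ (Real.exp_pos _)))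
  have h2 : ∀ ξ : ℝ, FourierTransform.fourier (mbF f) ξ * FourierTransform.fourier (mbF g) ξ
      = 0 := by
    intro ξ
    rw [← Real.fourier_mul_convolution_eq hiF hiG, Real.fourier_eq]
    apply integral_eq_zero_of_ae
    filter_upwards [h1] with u hu
    have := (mul_eq_zero.1 hu).resolve_left (mb_M_ne u)
    simp [this]
  have h3 := (mb_analytic _ hcF hwF).eq_zero_or_eq_zero_of_mul_eq_zero
    (mb_analytic _ hcG hwG) (fun z _ => h2 z) isPreconnected_univ
  exact h3.imp (fun h => hzF fun ξ => h ξ trivial) (fun h => hzG fun ξ => h ξ trivial)
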